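/- arXiv:2403.10909 — 2 statements merged into one kernel-verified Lean document; each statement's English description precedes it below -/
import Mathlib

section
/- Let M be a compact metric space with its Borel σ-algebra, let Y : [0,∞) × M → M be a jointly measurable semiflow, let Σ' ⊆ M be a measurable subset, let R : Σ' → (0,∞) be measurable such that the first-return map F(x) := Y_{R(x)}(x) satisfies F(x) ∈ Σ' for all x ∈ Σ', and let μ be an F-invariant Borel probability measure on Σ' with ∫_{Σ'} R dμ < ∞. Then for every bounded measurable function φ : M → ℝ and every s ≥ 0, ∫_{Σ'} ∫_0^{s} φ(Y_t(x)) dt dμ(x) = ∫_{Σ'} ∫_{R(x)}^{R(x)+s} φ(Y_t(x)) dt dμ(x). -/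
open MeasureTheory Filter Topology

/-- The key identity in the proof of invariance of the suspension
measure: integrating a bounded measurable observable over the time window `[0,s]`
against an invariant measure of the first-return map gives the same result as
integrating over the window `[R(x), R(x)+s]`. -/
theorem suspension_shift_identity
    {M : Type*} [MetricSpace M] [CompactSpace M] [MeasurableSpace M] [BorelSpace M]
    (Y : ℝ → M → M)
    (hYmeas : Measurable (Function.uncurry Y))
    (hY0 : ∀ x, Y 0 x = x)
    (hYadd : ∀ s t : ℝ, 0 ≤ s → 0 ≤ t → ∀ x, Y (t + s) x = Y t (Y s x))
    (S : Set M) (hS : MeasurableSet S)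
    (R : M → ℝ) (hRmeas : Measurable R) (hRpos : ∀ x ∈ S, 0 < R x)
    (hF : ∀ x ∈ S, Y (R x) x ∈ S)
    (μ : Measure M) [IsProbabilityMeasure μ] (hμS : μ Sᶜ = 0)
    (hμinv : Measure.map (fun x => Y (R x) x) μ = μ)
    (hRint_fin : ∫⁻ x, ENNReal.ofReal (R x) ∂μ < ⊤)
    (φ : M → ℝ) (hφmeas : Measurable φ) (hφbdd : ∃ C : ℝ, ∀ y, |φ y| ≤ C)
    (s : ℝ) (hs : 0 ≤ s) :
    ∫ x, (∫ t in (0:ℝ)..s, φ (Y t x)) ∂μ =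
      ∫ x, (∫ t in (R x)..(R x + s), φ (Y t x)) ∂μ := by
  have hF_meas : Measurable (fun x => Y (R x) x) :=
    hYmeas.comp (hRmeas.prodMk measurable_id)
  have hG : StronglyMeasurable (fun x => ∫ t in (0:ℝ)..s, φ (Y t x)) := by
    have h : StronglyMeasurable (Function.uncurry fun (x : M) (t : ℝ) => φ (Y t x)) :=
      (hφmeas.comp (hYmeas.comp measurable_swap)).stronglyMeasurable
    simp only [intervalIntegral.integral_of_le hs]
    exact h.integral_prod_right
  calc ∫ x, (∫ t in (0:ℝ)..s, φ (Y t x)) ∂μ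
      = ∫ x, (∫ t in (0:ℝ)..s, φ (Y t x)) ∂(Measure.map (fun x => Y (R x) x) μ) := by
        rw [hμinv]
    _ = ∫ x, (∫ t in (0:ℝ)..s, φ (Y t (Y (R x) x))) ∂μ :=
        integral_map hF_meas.aemeasurable hG.aestronglyMeasurable
    _ = ∫ x, (∫ t in (R x)..(R x + s), φ (Y t x)) ∂μ := by
        have hS_ae : ∀ᵐ x ∂μ, x ∈ S := hμS
        refine integral_congr_ae ?_
        filter_upwards [hS_ae] with x hx
        have hshift : ∫ t in (0:ℝ)..s, φ (Y t (Y (R x) x)) =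
            ∫ t in (0:ℝ)..s, φ (Y (t + R x) x) := by
          refine intervalIntegral.integral_congr fun t ht => ?_
          rw [Set.uIcc_of_le hs] at ht
          simp only [hYadd (R x) t (hRpos x hx).le ht.1 x]
        rw [hshift, intervalIntegral.integral_comp_add_right (fun t => φ (Y t x)) (R x),
          zero_add, add_comm s]
end

section
/- Let M be a compact metric space, f : M → M a continuous map, and μ a Borel probability measure on M whose basin B_μ is nonempty, where B_μ is the set of x ∈ M such that for every continuous φ : M → ℝ, (1/n) Σ_{j=0}^{n−1} φ(f^j(x)) → ∫ φ dμ as n → ∞. Then μ is f-invariant, i.e. f_* μ = μ. -/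
open MeasureTheory Filter Topology

/-- A Borel probability measure with nonempty basin for a continuous
map on a compact metric space is invariant. -/
theorem invariant_of_basin_nonempty
    {M : Type*} [MetricSpace M] [CompactSpace M] [MeasurableSpace M] [BorelSpace M]
    (f : M → M) (hf : Continuous f)
    (μ : Measure M) [IsProbabilityMeasure μ]
    (hbasin : ∃ x : M, ∀ φ : M → ℝ, Continuous φ →
      Tendsto (fun n : ℕ => (1 / (n : ℝ)) * ∑ j ∈ Finset.range n, φ (f^[j] x))
        atTop (nhds (∫ y, φ y ∂μ))) :
    Measure.map f μ = μ := by
  obtain ⟨x, hx⟩ := hbasin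
  have : IsProbabilityMeasure (Measure.map f μ) :=
    Measure.isProbabilityMeasure_map hf.measurable.aemeasurable
  refine ext_of_forall_integral_eq_of_IsFiniteMeasure fun φ => ?_
  rw [integral_map hf.measurable.aemeasurable φ.continuous.aestronglyMeasurable]
  have hsub := (hx (fun y => φ (f y)) (φ.continuous.comp hf)).sub (hx φ φ.continuous)
  have hzero := tendsto_birkhoffAverage_apply_sub_birkhoffAverage' ℝ φ.isBounded_range f x
  refine sub_eq_zero.mp (tendsto_nhds_unique (hsub.congr fun n => ?_) hzero)
  simp only [birkhoffAverage, birkhoffSum, one_div, smul_eq_mul,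
    ← Function.iterate_succ_apply, ← Function.iterate_succ_apply']
end
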